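/- arXiv:2309.15038 — 4 statements merged into one kernel-verified Lean document; each statement's English description precedes it below -/
import Mathlib

section
/- Let C be a finite nonempty type of classes, y ∈ C, s : C → ℝ, k : C → ℝ with k c ≥ 0 for all c, and τ > 0. Assume Σ_{c≠y} k c · exp(s c / τ) > 0. Then the partial derivative of L_PCR with respect to coordinate y is strictly negative; and for every c ≠ y, the partial derivative of L_PCR with respect to coordinate c is nonnegative, and it is strictly positive if and only if k c > 0. -/
/-- The partial derivative of the PCR loss at coordinate `c` is
`(k c * exp (s c / τ) / Z - δ_{c y}) / τ`. -/
theorem hasDerivAt_pcr_loss {C : Type*} [Fintype C] [DecidableEq C]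
    (y c : C) (s k : C → ℝ) (τ : ℝ) (hZ : ∑ j : C, k j * Real.exp (s j / τ) ≠ 0) :
    HasDerivAt (fun t : ℝ =>
        -Real.log (Real.exp (Function.update s c t y / τ) /
          ∑ j : C, k j * Real.exp (Function.update s c t j / τ)))
      ((k c * Real.exp (s c / τ) / (∑ j : C, k j * Real.exp (s j / τ)) -
        if c = y then 1 else 0) / τ) (s c) := by
  have hcoord (j : C) : HasDerivAt (fun t : ℝ => Function.update s c t j / τ)
      ((if c = j then 1 else 0) / τ) (s c) := by
    have h := (hasDerivAt_pi.1 (hasDerivAt_update s c (s c)) j).div_const τ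
    simpa [Pi.single_apply, eq_comm] using h
  have hsum : HasDerivAt (fun t : ℝ => ∑ j : C, k j * Real.exp (Function.update s c t j / τ))
      (k c * Real.exp (s c / τ) / τ) (s c) := by
    have h := HasDerivAt.fun_sum (u := Finset.univ)
      fun j _ => ((hcoord j).exp.const_mul (k j))
    refine h.congr_deriv ?_
    simp [div_eq_mul_inv, mul_assoc]
  have h := ((hcoord y).exp.fun_div hsum (by simpa using hZ)).log
    (div_ne_zero (Real.exp_ne_zero _) (by simpa using hZ)) |>.neg
  refine h.congr_deriv ?_
  have he := Real.exp_ne_zero (s y / τ)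
  simp only [Function.update_eq_self]
  field_simp
  ring

/-- **Signs of the PCR gradient.** If `Σ_{c ≠ y} k c * exp (s c / τ) > 0`, then the
partial derivative of the PCR loss at coordinate `y` is strictly negative, and for
every `c ≠ y` it is nonnegative, being strictly positive iff `k c > 0`. -/
theorem pcr_gradient_signs {C : Type*} [Fintype C] [Nonempty C] [DecidableEq C]
    (y : C) (s k : C → ℝ) (hk : ∀ c, 0 ≤ k c) (τ : ℝ) (hτ : 0 < τ)
    (hsumy : 0 < ∑ c ∈ Finset.univ.erase y, k c * Real.exp (s c / τ)) :
    deriv (fun t : ℝ =>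
        -Real.log (Real.exp (Function.update s y t y / τ) /
          ∑ j : C, k j * Real.exp (Function.update s y t j / τ))) (s y) < 0 ∧
    ∀ c : C, c ≠ y →
      (0 ≤ deriv (fun t : ℝ =>
          -Real.log (Real.exp (Function.update s c t y / τ) /
            ∑ j : C, k j * Real.exp (Function.update s c t j / τ))) (s c) ∧
       (0 < deriv (fun t : ℝ =>
          -Real.log (Real.exp (Function.update s c t y / τ) /
            ∑ j : C, k j * Real.exp (Function.update s c t j / τ))) (s c) ↔ 0 < k c)) := by
  have hterm (c : C) : 0 ≤ k c * Real.exp (s c / τ) := mul_nonneg (hk c) (Real.exp_pos _).le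
  have hsplit := Finset.add_sum_erase Finset.univ (fun c => k c * Real.exp (s c / τ))
    (Finset.mem_univ y)
  have hZ : 0 < ∑ j : C, k j * Real.exp (s j / τ) := by
    have := hterm y
    linarith
  refine ⟨?_, fun c hc => ?_⟩
  · rw [(hasDerivAt_pcr_loss y y s k τ hZ.ne').deriv, if_pos rfl]
    refine div_neg_of_neg_of_pos (sub_neg.2 ((div_lt_one hZ).2 ?_)) hτ
    linarith
  · rw [(hasDerivAt_pcr_loss y c s k τ hZ.ne').deriv, if_neg hc, sub_zero]
    refine ⟨div_nonneg (div_nonneg (hterm c) hZ.le) hτ.le, ?_⟩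
    rw [div_pos_iff_of_pos_right hτ, div_pos_iff_of_pos_right hZ,
      mul_pos_iff_of_pos_right (Real.exp_pos _)]
end

section
/- Let C be a finite nonempty type of classes, y ∈ C, s : C → ℝ, and k : C → ℝ with k c ≥ 0 for all c and Σ_{j≠y} k j > 0. Then for every class c ≠ y, the relative penalty r_τ(c) = k c · exp(s c / τ) / Σ_{j≠y} k j · exp(s j / τ) tends to k c / Σ_{j≠y} k j as the temperature τ tends to +∞; i.e., in the high-temperature limit all negative classes are penalized in proportion to their counts. -/
open Filter

/-- A Boltzmann weight `b * exp (a / τ)` tends to its prefactor `b` as `τ → +∞`. -/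
theorem tendsto_mul_exp_div_atTop (a b : ℝ) :
    Tendsto (fun τ : ℝ => b * Real.exp (a / τ)) atTop (nhds b) := by
  have h : Tendsto (fun τ : ℝ => a / τ) atTop (nhds 0) := tendsto_const_nhds.div_atTop tendsto_id
  simpa using ((Real.continuous_exp.tendsto 0).comp h).const_mul b

/-- **High-temperature limit of the relative penalty.** If `Σ_{j ≠ y} k j > 0`, then
for every `c ≠ y`, the relative penalty
`r_τ(c) = k c * exp (s c / τ) / Σ_{j ≠ y} k j * exp (s j / τ)` tends to
`k c / Σ_{j ≠ y} k j` as `τ → +∞`. -/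
theorem pcr_penalty_high_temperature_limit {C : Type*} [Fintype C] [Nonempty C]
    [DecidableEq C] (y : C) (s k : C → ℝ) (hk : ∀ c, 0 ≤ k c)
    (hksum : 0 < ∑ j ∈ Finset.univ.erase y, k j) :
    ∀ c : C, c ≠ y →
      Tendsto (fun τ : ℝ =>
          k c * Real.exp (s c / τ) /
            ∑ j ∈ Finset.univ.erase y, k j * Real.exp (s j / τ))
        atTop (nhds (k c / ∑ j ∈ Finset.univ.erase y, k j)) := by
  intro c _
  exact (tendsto_mul_exp_div_atTop (s c) (k c)).div
    (tendsto_finsetSum _ fun j _ => tendsto_mul_exp_div_atTop (s j) (k j)) hksum.ne'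
end

section
/- Let C be a finite nonempty type of classes, y ∈ C, s : C → ℝ, and k : C → ℝ with k c ≥ 0 for all c. Suppose c* ≠ y satisfies k c* > 0 and s c* > s j for every class j ≠ y with j ≠ c* and k j > 0. Then the relative penalty r_τ(c*) = k c* · exp(s c* / τ) / Σ_{j≠y} k j · exp(s j / τ) tends to 1 as the temperature τ tends to 0 from the right; i.e., in the low-temperature limit the penalty concentrates on the negative class with the highest similarity. -/
open Filter

/-- A Boltzmann factor with negative exponent vanishes in the low-temperature limit. -/
theorem tendsto_exp_div_nhdsGT_zero_of_neg {a : ℝ} (ha : a < 0) :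
    Tendsto (fun τ : ℝ => Real.exp (a / τ)) (nhdsWithin 0 (Set.Ioi 0)) (nhds 0) := by
  simp only [div_eq_mul_inv]
  exact Real.tendsto_exp_atBot.comp (tendsto_inv_nhdsGT_zero.const_mul_atTop_of_neg ha)

/-- **Low-temperature limit of the relative penalty.** If `c* ≠ y` has `k c* > 0` and
strictly the highest similarity among negative classes with positive count, then
`r_τ(c*) = k c* * exp (s c* / τ) / Σ_{j ≠ y} k j * exp (s j / τ)` tends to `1` as
`τ → 0⁺`. -/
theorem pcr_penalty_low_temperature_limit {C : Type*} [Fintype C] [Nonempty C]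
    [DecidableEq C] (y : C) (s k : C → ℝ) (hk : ∀ c, 0 ≤ k c)
    (cstar : C) (hcy : cstar ≠ y) (hkc : 0 < k cstar)
    (hmax : ∀ j : C, j ≠ y → j ≠ cstar → 0 < k j → s j < s cstar) :
    Tendsto (fun τ : ℝ =>
        k cstar * Real.exp (s cstar / τ) /
          ∑ j ∈ Finset.univ.erase y, k j * Real.exp (s j / τ))
      (nhdsWithin 0 (Set.Ioi 0)) (nhds 1) := by
  have hterm : ∀ j ∈ Finset.univ.erase y,
      Tendsto (fun τ : ℝ => k j * Real.exp ((s j - s cstar) / τ))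
        (nhdsWithin 0 (Set.Ioi 0)) (nhds (if j = cstar then k cstar else 0)) := by
    intro j hj
    by_cases hjc : j = cstar
    · simp [hjc]
    rw [if_neg hjc]
    rcases (hk j).eq_or_lt with h0 | hpos
    · simp [← h0]
    · simpa using (tendsto_exp_div_nhdsGT_zero_of_neg
        (sub_neg.mpr (hmax j (Finset.ne_of_mem_erase hj) hjc hpos))).const_mul (k j)
  have hsum := tendsto_finsetSum _ hterm
  rw [Finset.sum_ite_eq' _ cstar, if_pos (by simp [hcy])] at hsum
  have hlim := (tendsto_const_nhds (x := k cstar)).div hsum hkc.ne'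
  rw [div_self hkc.ne'] at hlim
  refine hlim.congr fun τ => ?_
  have hfactor : ∑ j ∈ Finset.univ.erase y, k j * Real.exp (s j / τ) =
      (∑ j ∈ Finset.univ.erase y, k j * Real.exp ((s j - s cstar) / τ)) *
        Real.exp (s cstar / τ) := by
    rw [Finset.sum_mul]
    refine Finset.sum_congr rfl fun j _ => ?_
    rw [mul_assoc, ← Real.exp_add, ← add_div, sub_add_cancel]
  rw [hfactor, mul_div_mul_right _ _ (Real.exp_ne_zero _)]
  rfl
end

section
/- Let C be a finite nonempty type of classes, y ∈ C, s : C → ℝ, k : C → ℝ with k c ≥ 0 for all c, and τ > 0, τ' > 0. Assume Z := Σ_{j∈C} k j · exp(s j / τ) > 0. For the rescaled PCR loss L(s) = −(τ/τ') · log(exp(s y / τ) / Z), the partial derivative of L with respect to coordinate c equals (k y · p*_y − 1)/τ' if c = y, and equals (k c · p*_c)/τ' if c ≠ y, where p*_c = exp(s c / τ)/Z; i.e., rescaling the loss by τ/τ' replaces the factor 1/τ in the gradient by 1/τ' while leaving the probabilities p* computed at temperature τ. -/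
/-- The partial derivative in coordinate `c` of `s ↦ exp (s j / τ)`. -/
theorem hasDerivAt_exp_update_div {C : Type*} [Fintype C] [DecidableEq C]
    (s : C → ℝ) (τ : ℝ) (c j : C) :
    HasDerivAt (fun t : ℝ => Real.exp (Function.update s c t j / τ))
      (Real.exp (s j / τ) * ((if j = c then 1 else 0) / τ)) (s c) := by
  have h := hasDerivAt_pi.1 (hasDerivAt_update s c (s c)) j
  simpa [Pi.single_apply] using (h.div_const τ).exp

/-- The partial derivative in coordinate `c` of `s ↦ ∑ j, k j * exp (s j / τ)`. -/
theorem hasDerivAt_sum_exp_update_div {C : Type*} [Fintype C] [DecidableEq C]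
    (s k : C → ℝ) (τ : ℝ) (c : C) :
    HasDerivAt (fun t : ℝ => ∑ j : C, k j * Real.exp (Function.update s c t j / τ))
      (k c * (Real.exp (s c / τ) / τ)) (s c) := by
  have h := HasDerivAt.fun_sum (u := Finset.univ)
    fun j _ => (hasDerivAt_exp_update_div s τ c j).const_mul (k j)
  refine h.congr_deriv ?_
  rw [Finset.sum_eq_single c (fun j _ hj => by simp [hj]) (by simp)]
  simp [div_eq_mul_inv]

/-- **Decoupled-temperature PCR gradient.** For the rescaled loss
`L(s) = -(τ/τ') * log (exp (s y / τ) / Z)` with `Z = Σ_j k j * exp (s j / τ) > 0`,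
the partial derivative w.r.t. coordinate `c` is `(k y * p*_y - 1)/τ'` if `c = y` and
`(k c * p*_c)/τ'` otherwise, with `p*_c = exp (s c / τ) / Z`: the gradient scale `1/τ`
is replaced by `1/τ'` while the probabilities stay at temperature `τ`. -/
theorem pcr_decoupled_temperature_gradient {C : Type*} [Fintype C] [Nonempty C]
    [DecidableEq C] (y : C) (s k : C → ℝ) (hk : ∀ c, 0 ≤ k c)
    (τ τ' : ℝ) (hτ : 0 < τ) (hτ' : 0 < τ')
    (hZ : 0 < ∑ j : C, k j * Real.exp (s j / τ)) :
    ∀ c : C,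
      deriv (fun t : ℝ =>
          -((τ / τ') * Real.log (Real.exp (Function.update s c t y / τ) /
            ∑ j : C, k j * Real.exp (Function.update s c t j / τ)))) (s c) =
        if c = y then
          (k y * (Real.exp (s y / τ) / ∑ j : C, k j * Real.exp (s j / τ)) - 1) / τ'
        else
          (k c * (Real.exp (s c / τ) / ∑ j : C, k j * Real.exp (s j / τ))) / τ' := by
  intro c
  have hN := hasDerivAt_exp_update_div s τ c y
  have hS := hasDerivAt_sum_exp_update_div s k τ c
  have hL := (((hN.fun_div hS (by simpa using hZ.ne')).log
    (by simpa using hZ.ne')).const_mul (τ / τ')).fun_neg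
  rw [hL.deriv]
  simp only [Function.update_eq_self]
  generalize (∑ j : C, k j * Real.exp (s j / τ)) = Z at hZ ⊢
  split_ifs with h₁ h₂ h₂
  · subst h₁
    field_simp
    ring
  · exact absurd h₁.symm h₂
  · exact absurd h₂.symm h₁
  · field_simp
    ring
end
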